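/- arXiv:1905.00672 — 6 statements merged into one kernel-verified Lean document; each statement's English description precedes it below -/
import Mathlib

section
/- Let n ≥ 2 be a natural number, ε ∈ (0,1], and λ > 0. Let F be the set of all functions x assigning to each ordered pair (u,v) of distinct elements of {1,…,n} a value x_{u,v} ∈ {0,1}, subject to: (i) Σ_{u≠v} x_{u,v} ≥ ε·(n choose 2); (ii) x_{u,v} + x_{v,u} ≤ 1 for all distinct u,v; (iii) x_{u,w} ≥ x_{u,v} + x_{v,w} − 1 for all pairwise distinct u,v,w. Let p and p̂ be functions from ordered pairs of distinct elements of {1,…,n} to the reals with p_{u,v} ∈ [0,1] for all pairs and |p̂_{u,v} − p_{u,v}| ≤ λ for all pairs. Define J(x) = (Σ_{u≠v} p_{u,v} x_{u,v}) / (Σ_{u≠v} x_{u,v}) and Ĵ(x) = (Σ_{u≠v} p̂_{u,v} x_{u,v}) / (Σ_{u≠v} x_{u,v}) for x ∈ F. Then |max_{x∈F} Ĵ(x) − max_{x∈F} J(x)| ≤ 3λ. -/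
open Finset

/-- Perturbing the averaged values by at most `c` perturbs a weighted average by at most `c`. -/
theorem abs_weightedAverage_sub_le {ι : Type*} (s : Finset ι) (a b w : ι → ℝ) {c : ℝ}
    (hc : 0 ≤ c) (hw : ∀ i ∈ s, 0 ≤ w i) (hab : ∀ i ∈ s, |a i - b i| ≤ c) :
    |(∑ i ∈ s, a i * w i) / (∑ i ∈ s, w i) - (∑ i ∈ s, b i * w i) / (∑ i ∈ s, w i)| ≤ c := by
  have hW : 0 ≤ ∑ i ∈ s, w i := Finset.sum_nonneg hw
  rw [← sub_div, ← Finset.sum_sub_distrib, abs_div, abs_of_nonneg hW]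
  refine div_le_of_le_mul₀ hW hc ?_
  rw [Finset.mul_sum]
  refine (Finset.abs_sum_le_sum_abs _ _).trans (Finset.sum_le_sum fun i hi => ?_)
  rw [← sub_mul, abs_mul, abs_of_nonneg (hw i hi)]
  exact mul_le_mul_of_nonneg_right (hab i hi) (hw i hi)

/-- The maxima over a set of two functions that are uniformly `c`-close on it are `c`-close. -/
theorem IsGreatest.abs_sub_le_of_image {α : Type*} {s : Set α} {f g : α → ℝ} {a b c : ℝ}
    (ha : IsGreatest (f '' s) a) (hb : IsGreatest (g '' s) b)
    (hfg : ∀ x ∈ s, |f x - g x| ≤ c) : |a - b| ≤ c := by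
  obtain ⟨⟨x, hx, rfl⟩, hf⟩ := ha
  obtain ⟨⟨y, hy, rfl⟩, hg⟩ := hb
  have hyx := hf (Set.mem_image_of_mem f hy)
  have hxy := hg (Set.mem_image_of_mem g hx)
  have h₁ := abs_le.mp (hfg x hx)
  have h₂ := abs_le.mp (hfg y hy)
  rw [abs_le]
  constructor <;> linarith

/-- Lemma 1 (effect of perturbing the coefficients `p_{u,v}` on the optimal value of the
integer program): if `|p̂_{u,v} - p_{u,v}| ≤ λ` for all distinct pairs, then the maxima of
the objective `J` and the perturbed objective `Ĵ` over the feasible set `F` of the integer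
program differ by at most `3λ`. -/
theorem perturbed_integer_program_optimum_close
    (n : ℕ) (hn : 2 ≤ n) (ε : ℝ) (hε0 : 0 < ε) (hε1 : ε ≤ 1)
    (lam : ℝ) (hlam : 0 < lam)
    (p phat : Fin n → Fin n → ℝ)
    (hp : ∀ u v : Fin n, u ≠ v → 0 ≤ p u v ∧ p u v ≤ 1)
    (happrox : ∀ u v : Fin n, u ≠ v → |phat u v - p u v| ≤ lam)
    (F : Set (Fin n → Fin n → ℝ))
    (hF : F = {x | (∀ u v : Fin n, u ≠ v → x u v = 0 ∨ x u v = 1) ∧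
      (ε * (n.choose 2 : ℝ) ≤
        ∑ q ∈ Finset.univ.filter (fun q : Fin n × Fin n => q.1 ≠ q.2), x q.1 q.2) ∧
      (∀ u v : Fin n, u ≠ v → x u v + x v u ≤ 1) ∧
      (∀ u v w : Fin n, u ≠ v → v ≠ w → u ≠ w → x u v + x v w - 1 ≤ x u w)})
    (J Jhat : (Fin n → Fin n → ℝ) → ℝ)
    (hJ : ∀ x, J x =
      (∑ q ∈ Finset.univ.filter (fun q : Fin n × Fin n => q.1 ≠ q.2), p q.1 q.2 * x q.1 q.2) /
      (∑ q ∈ Finset.univ.filter (fun q : Fin n × Fin n => q.1 ≠ q.2), x q.1 q.2))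
    (hJhat : ∀ x, Jhat x =
      (∑ q ∈ Finset.univ.filter (fun q : Fin n × Fin n => q.1 ≠ q.2), phat q.1 q.2 * x q.1 q.2) /
      (∑ q ∈ Finset.univ.filter (fun q : Fin n × Fin n => q.1 ≠ q.2), x q.1 q.2))
    (M Mhat : ℝ)
    (hM : IsGreatest (J '' F) M) (hMhat : IsGreatest (Jhat '' F) Mhat) :
    |Mhat - M| ≤ 3 * lam := by
  have h : |Mhat - M| ≤ lam := by
    refine hMhat.abs_sub_le_of_image hM fun x hx => ?_
    rw [hF, Set.mem_ofPred_eq] at hx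
    obtain ⟨h01, -⟩ := hx
    have hne : ∀ q ∈ Finset.univ.filter (fun q : Fin n × Fin n => q.1 ≠ q.2), q.1 ≠ q.2 :=
      fun q hq => (Finset.mem_filter.mp hq).2
    rw [hJ, hJhat]
    generalize Finset.univ.filter (fun q : Fin n × Fin n => q.1 ≠ q.2) = s at hne ⊢
    refine abs_weightedAverage_sub_le s (fun q => phat q.1 q.2) (fun q => p q.1 q.2)
      (fun q => x q.1 q.2) hlam.le (fun q hq => ?_) (fun q hq => happrox q.1 q.2 (hne q hq))
    rcases h01 q.1 q.2 (hne q hq) with h | h <;> simp [h]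
  linarith
end

section
/- Let S be a finite type of states, let t₀ < T be natural numbers, and for each time s with t₀ < s ≤ T let w_s : S × S → ℝ≥0 (transition weights) and q_s : S × S → ℝ≥0 (sampling kernel) satisfy: for every h ∈ S, Σ_{h'∈S} q_s(h,h') = 1, and q_s(h,h') > 0 whenever w_s(h,h') > 0. Define D : {t₀,…,T} × S → ℝ recursively by D(t₀,h) = 1 and D(s,h) = Σ_{h'∈S} w_s(h,h')·D(s−1,h') for t₀ < s ≤ T. Fix H ∈ S and let (X_T, X_{T−1}, …, X_{t₀}) be the time-inhomogeneous Markov chain started at X_T = H in which X_{s−1} is drawn according to the distribution q_s(X_s, ·). Then E[ ∏_{s=t₀+1}^{T} w_s(X_s, X_{s−1}) / q_s(X_s, X_{s−1}) ] = D(T, H); equivalently, the expectation equals the sum over all backward paths (h_T = H, h_{T−1}, …, h_{t₀}) of ∏_{s=t₀+1}^{T} w_s(h_s, h_{s−1}). -/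
open Finset

/-- Summing over the functions on `Fin (n + 1)` with a prescribed value at `0` amounts to summing
over their tails. -/
theorem sum_filter_apply_zero_eq_sum_cons {S M : Type*} [Fintype S] [DecidableEq S]
    [AddCommMonoid M] {n : ℕ} (a : S) (f : (Fin (n + 1) → S) → M) :
    ∑ h ∈ Finset.univ.filter (fun h : Fin (n + 1) → S => h 0 = a), f h =
      ∑ g : Fin n → S, f (Fin.cons a g) := by
  refine Finset.sum_bij' (fun h _ => Fin.tail h) (fun g _ => Fin.cons a g) ?_ ?_ ?_ ?_ ?_
  · simp
  · simp
  · rintro h hh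
    obtain rfl : h 0 = a := by simpa using hh
    exact Fin.cons_self_tail h
  · simp
  · rintro h hh
    obtain rfl : h 0 = a := by simpa using hh
    exact congrArg f (Fin.cons_self_tail h).symm

/-- A function defined by a terminal value `1` and a weighted backward recursion is the sum over
paths of the products of the weights. -/
theorem sum_paths_prod_eq_of_recursion {S R : Type*} [Fintype S] [DecidableEq S]
    [CommSemiring R] (n : ℕ) (w : ℕ → S → S → R) (E : ℕ → S → R)
    (hE_last : ∀ a, E n a = 1)
    (hE_step : ∀ i < n, ∀ a, E i a = ∑ b, w i a b * E (i + 1) b) (a : S) :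
    ∑ h ∈ Finset.univ.filter (fun h : Fin (n + 1) → S => h 0 = a),
      ∏ i : Fin n, w i (h i.castSucc) (h i.succ) = E 0 a := by
  induction n generalizing w E a with
  | zero => rw [sum_filter_apply_zero_eq_sum_cons]; simp [hE_last]
  | succ n ih =>
    rw [sum_filter_apply_zero_eq_sum_cons, hE_step 0 n.succ_pos,
      ← Finset.sum_fiberwise Finset.univ (fun g : Fin (n + 1) → S => g 0)]
    refine Finset.sum_congr rfl fun b _ => ?_
    rw [← ih (fun i => w (i + 1)) (fun i => E (i + 1)) hE_last
      (fun i hi => hE_step (i + 1) (Nat.succ_lt_succ hi)) b, Finset.mul_sum]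
    refine Finset.sum_congr rfl fun g hg => ?_
    obtain rfl : g 0 = b := by simpa using hg
    simp [Fin.prod_univ_succ]

/-- Theorem 1 (sequential importance sampling identity): for the time-inhomogeneous Markov
chain started at `X_T = H` with transition kernels `q_s`, the expectation of the product of
the importance weights `w_s(X_s, X_{s-1}) / q_s(X_s, X_{s-1})` equals `D(T, H)`, where `D` is
defined by the recursion `D(t₀, h) = 1`, `D(s, h) = Σ_{h'} w_s(h, h') · D(s-1, h')`;
equivalently it equals the sum over all backward paths `(h_T = H, …, h_{t₀})` of
`∏_s w_s(h_s, h_{s-1})`.  The expectation is written out explicitly as the sum over all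
backward paths of the path probability (product of the `q`'s) times the weight product. -/
theorem importance_sampling_expectation_eq
    {S : Type*} [Fintype S] [DecidableEq S]
    (t₀ T : ℕ) (hT : t₀ < T)
    (w q : ℕ → S → S → ℝ)
    (hw_nonneg : ∀ s, t₀ < s → s ≤ T → ∀ a b : S, 0 ≤ w s a b)
    (hq_nonneg : ∀ s, t₀ < s → s ≤ T → ∀ a b : S, 0 ≤ q s a b)
    (hq_sum : ∀ s, t₀ < s → s ≤ T → ∀ a : S, ∑ b : S, q s a b = 1)
    (hq_pos : ∀ s, t₀ < s → s ≤ T → ∀ a b : S, 0 < w s a b → 0 < q s a b)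
    (D : ℕ → S → ℝ)
    (hD0 : ∀ h : S, D t₀ h = 1)
    (hDs : ∀ s, t₀ < s → s ≤ T → ∀ h : S, D s h = ∑ h' : S, w s h h' * D (s - 1) h')
    (H : S) :
    -- a backward path is `h : Fin (T - t₀ + 1) → S`, where `h i` is the state at time `T - i`
    -- (so `h 0 = H` is the state at time `T` and the transition at time `s = T - i` goes
    -- from `h i.castSucc` to `h i.succ`)
    (∑ h ∈ Finset.univ.filter (fun h : Fin (T - t₀ + 1) → S => h 0 = H),
        (∏ i : Fin (T - t₀), q (T - (i : ℕ)) (h i.castSucc) (h i.succ)) *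
        (∏ i : Fin (T - t₀),
          w (T - (i : ℕ)) (h i.castSucc) (h i.succ) /
            q (T - (i : ℕ)) (h i.castSucc) (h i.succ)))
      = D T H ∧
    (∑ h ∈ Finset.univ.filter (fun h : Fin (T - t₀ + 1) → S => h 0 = H),
        ∏ i : Fin (T - t₀), w (T - (i : ℕ)) (h i.castSucc) (h i.succ))
      = D T H := by
  have hpaths : (∑ h ∈ Finset.univ.filter (fun h : Fin (T - t₀ + 1) → S => h 0 = H),
      ∏ i : Fin (T - t₀), w (T - (i : ℕ)) (h i.castSucc) (h i.succ)) = D T H := by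
    refine sum_paths_prod_eq_of_recursion (T - t₀) (fun i => w (T - i)) (fun i => D (T - i))
      (fun a => ?_) (fun i hi a => ?_) H
    · simpa [Nat.sub_sub_self hT.le] using hD0 a
    · exact hDs (T - i) (by omega) (by omega) a
  refine ⟨?_, hpaths⟩
  rw [← hpaths]
  refine Finset.sum_congr rfl fun h _ => ?_
  rw [← Finset.prod_mul_distrib]
  refine Finset.prod_congr rfl fun i _ => ?_
  have hlt : t₀ < T - (i : ℕ) := by omega
  have hle : T - (i : ℕ) ≤ T := Nat.sub_le _ _
  refine mul_div_cancel_of_imp' fun hq => ?_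
  refine le_antisymm (not_lt.mp fun hw => ?_) (hw_nonneg _ hlt hle _ _)
  exact (hq_pos _ hlt hle _ _ hw).ne' hq
end

section
/- Let n ≥ 1, let (Ω, P) be a finite probability space, let 𝒢 : Ω → SimpleGraph(Fin n) be a random graph, and let π : Ω → Perm(Fin n) be uniformly distributed on the symmetric group of Fin n and independent of 𝒢. A permutation σ acts on a simple graph G by relabeling: (σ(G)).Adj x y ↔ G.Adj (σ⁻¹ x) (σ⁻¹ y). Then for every simple graph H on Fin n with P(π(𝒢) = H) > 0 and every pair of distinct vertices u, v: P( π⁻¹(u) < π⁻¹(v) | π(𝒢) = H ) = ( Σ_{σ ∈ Perm(Fin n), σ⁻¹(u) < σ⁻¹(v)} P(𝒢 = σ⁻¹(H)) ) / ( Σ_{σ ∈ Perm(Fin n)} P(𝒢 = σ⁻¹(H)) ), where < is the natural order on Fin n. -/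
open Finset

/-- Splitting an event according to the value of a finitely valued random variable. -/
theorem sum_ite_and_eq_sum_filter_fiber {Ω α M : Type*} [Fintype Ω] [Fintype α] [AddCommMonoid M]
    [DecidableEq α] (P : Ω → M) (X : Ω → α) (Q : α → Prop) [DecidablePred Q]
    (R : α → Ω → Prop) [∀ a, DecidablePred (R a)] :
    (∑ ω, if Q (X ω) ∧ R (X ω) ω then P ω else 0)
      = ∑ a ∈ Finset.univ.filter Q, ∑ ω, if X ω = a ∧ R a ω then P ω else 0 := by
  rw [Finset.sum_comm]
  refine Finset.sum_congr rfl fun ω _ => ?_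
  simp only [ite_and, Finset.sum_ite_eq, Finset.mem_filter, Finset.mem_univ, true_and]

/-- An action by relabeling is inverted by relabeling with the inverse permutation. -/
theorem relabel_eq_iff_eq_relabel_inv {V : Type*}
    (act : Equiv.Perm V → SimpleGraph V → SimpleGraph V)
    (hact : ∀ (σ : Equiv.Perm V) (G : SimpleGraph V) (x y : V),
      (act σ G).Adj x y ↔ G.Adj (σ⁻¹ x) (σ⁻¹ y))
    (σ : Equiv.Perm V) (G H : SimpleGraph V) :
    act σ G = H ↔ G = act σ⁻¹ H := by
  constructor <;> rintro rfl <;> ext x y <;> simp [hact]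

open scoped Classical in
/-- Expression for `p_{u,v}(H)`: if `𝒢` is a random graph on `Fin n` (vertices labeled by
arrival order), `π` is a uniformly random permutation independent of `𝒢`, and `H` is an
observed relabeled graph (an outcome of `π(𝒢)` with positive probability), then for distinct
vertices `u, v` the conditional probability that `u` arrived before `v` given `π(𝒢) = H` is
`(Σ_{σ : σ⁻¹(u) < σ⁻¹(v)} P(𝒢 = σ⁻¹(H))) / (Σ_σ P(𝒢 = σ⁻¹(H)))`.  A permutation `σ` acts
on a graph by relabeling: `(σ(G)).Adj x y ↔ G.Adj (σ⁻¹ x) (σ⁻¹ y)`. -/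
theorem conditional_arrival_order_probability
    (n : ℕ) (hn : 1 ≤ n)
    {Ω : Type*} [Fintype Ω] (P : Ω → ℝ)
    (hP_nonneg : ∀ ω, 0 ≤ P ω) (hP_sum : ∑ ω, P ω = 1)
    (𝒢 : Ω → SimpleGraph (Fin n)) (π : Ω → Equiv.Perm (Fin n))
    (act : Equiv.Perm (Fin n) → SimpleGraph (Fin n) → SimpleGraph (Fin n))
    (hact : ∀ (σ : Equiv.Perm (Fin n)) (G : SimpleGraph (Fin n)) (x y : Fin n),
      (act σ G).Adj x y ↔ G.Adj (σ⁻¹ x) (σ⁻¹ y))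
    (hπ_unif : ∀ σ : Equiv.Perm (Fin n),
      (∑ ω, if π ω = σ then P ω else 0) = 1 / (n.factorial : ℝ))
    (hindep : ∀ (σ : Equiv.Perm (Fin n)) (G : SimpleGraph (Fin n)),
      (∑ ω, if π ω = σ ∧ 𝒢 ω = G then P ω else 0)
        = (∑ ω, if π ω = σ then P ω else 0) * (∑ ω, if 𝒢 ω = G then P ω else 0))
    (H : SimpleGraph (Fin n))
    (hH_pos : 0 < ∑ ω, if act (π ω) (𝒢 ω) = H then P ω else 0)
    (u v : Fin n) (huv : u ≠ v) :
    (∑ ω, if (π ω)⁻¹ u < (π ω)⁻¹ v ∧ act (π ω) (𝒢 ω) = H then P ω else 0) /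
      (∑ ω, if act (π ω) (𝒢 ω) = H then P ω else 0)
    = (∑ σ ∈ Finset.univ.filter
          (fun σ : Equiv.Perm (Fin n) => σ⁻¹ u < σ⁻¹ v),
          ∑ ω, if 𝒢 ω = act σ⁻¹ H then P ω else 0) /
      (∑ σ : Equiv.Perm (Fin n), ∑ ω, if 𝒢 ω = act σ⁻¹ H then P ω else 0) := by
  have joint : ∀ (Q : Equiv.Perm (Fin n) → Prop) [DecidablePred Q],
      (∑ ω, if Q (π ω) ∧ act (π ω) (𝒢 ω) = H then P ω else 0)
        = 1 / (n.factorial : ℝ) *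
          ∑ σ ∈ Finset.univ.filter Q, ∑ ω, if 𝒢 ω = act σ⁻¹ H then P ω else 0 := by
    intro Q _
    simp only [relabel_eq_iff_eq_relabel_inv act hact]
    rw [sum_ite_and_eq_sum_filter_fiber P π Q fun σ ω => 𝒢 ω = act σ⁻¹ H, Finset.mul_sum]
    refine Finset.sum_congr rfl fun σ _ => ?_
    rw [← hπ_unif σ, ← hindep]
  have num := joint fun σ => σ⁻¹ u < σ⁻¹ v
  have den := joint fun _ => True
  simp only [true_and, Finset.filter_true] at den
  have hfact : (1 / (n.factorial : ℝ)) ≠ 0 := by positivity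
  rw [num, den, mul_div_mul_left _ _ hfact]
end

section
/- Let p ∈ (0,1] and r ≥ 0 be real numbers. There exist a natural number s₀ ≥ 1 and real constants 0 < c₁ ≤ c₂ such that for all natural numbers s, t with s₀ ≤ s ≤ t: c₁·(t/s)^p ≤ ∏_{k=s}^{t−1} (1 + p/k − r/k²) ≤ c₂·(t/s)^p. -/
open Finset

theorem le_mul_prod_Ico_of_le_mul {a f : ℕ → ℝ} {s t : ℕ} (hst : s ≤ t)
    (hf : ∀ k, s ≤ k → 0 ≤ f k) (h : ∀ k, s ≤ k → a (k + 1) ≤ a k * f k) :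
    a t ≤ a s * ∏ k ∈ Finset.Ico s t, f k := by
  induction t, hst using Nat.le_induction with
  | base => simp
  | succ n hn ih =>
    rw [Finset.prod_Ico_succ_top hn, ← mul_assoc]
    exact (h n hn).trans (mul_le_mul_of_nonneg_right ih (hf n hn))

theorem mul_prod_Ico_le_of_mul_le {a f : ℕ → ℝ} {s t : ℕ} (hst : s ≤ t)
    (hf : ∀ k, s ≤ k → 0 ≤ f k) (h : ∀ k, s ≤ k → a k * f k ≤ a (k + 1)) :
    a s * ∏ k ∈ Finset.Ico s t, f k ≤ a t := by
  induction t, hst using Nat.le_induction with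
  | base => simp
  | succ n hn ih =>
    rw [Finset.prod_Ico_succ_top hn, ← mul_assoc]
    exact (mul_le_mul_of_nonneg_right ih (hf n hn)).trans (h n hn)

/-- Bernoulli's inequality for exponents in `[0, 1]`, in homogeneous form. -/
theorem rpow_add_one_le_rpow_mul {p x : ℝ} (hp0 : 0 ≤ p) (hp1 : p ≤ 1) (hx : 0 < x) :
    (x + 1) ^ p ≤ x ^ p * (1 + p / x) := by
  have hx' : 0 < 1 / x := by positivity
  have e : x + 1 = x * (1 + 1 / x) := by field_simp
  rw [e, Real.mul_rpow hx.le (by positivity)]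
  have h := rpow_one_add_le_one_add_mul_self (s := 1 / x) (by linarith) hp0 hp1
  rw [mul_one_div] at h
  gcongr

/-- Lower bound on `(x + 1) ^ p` obtained from Bernoulli's inequality with exponent `1 - p`. -/
theorem rpow_mul_add_one_le {p x : ℝ} (hp0 : 0 ≤ p) (hp1 : p ≤ 1) (hx : 0 < x) :
    x ^ p * (x + 1) ≤ (x + 1) ^ p * (x + (1 - p)) := by
  have h := rpow_add_one_le_rpow_mul (p := 1 - p) (by linarith) (by linarith) hx
  have hx1 : 0 < x + 1 := by linarith
  rw [Real.rpow_sub hx1, Real.rpow_sub hx, Real.rpow_one, Real.rpow_one] at h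
  have e : x / x ^ p * (1 + (1 - p) / x) = (x + (1 - p)) / x ^ p := by field_simp
  rw [e, div_le_div_iff₀ (by positivity) (by positivity)] at h
  linarith

theorem duplication_factor_lower_step {p r x : ℝ} (hp0 : 0 ≤ p) (hp1 : p ≤ 1) (hr : 0 ≤ r)
    (hx : r + 1 < x) :
    (x + 1) ^ p * ((x + 1) / (x + 1 - (r + 1))) ≤
      x ^ p * (x / (x - (r + 1))) * (1 + p / x - r / x ^ 2) := by
  have hx0 : 0 < x := by linarith
  have h1 : 0 < x - (r + 1) := by linarith
  have h2 : 0 < x + 1 - (r + 1) := by linarith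
  have key : (1 + p / x) * ((x + 1) / (x + 1 - (r + 1))) ≤
      x / (x - (r + 1)) * (1 + p / x - r / x ^ 2) := by
    have e1 : (1 + p / x) * ((x + 1) / (x + 1 - (r + 1))) =
        (x + p) * (x + 1) / (x * (x + 1 - (r + 1))) := by field_simp
    have e2 : x / (x - (r + 1)) * (1 + p / x - r / x ^ 2) =
        (x ^ 2 + p * x - r) / (x * (x - (r + 1))) := by field_simp
    rw [e1, e2, div_le_div_iff₀ (by positivity) (by positivity)]
    have : 0 ≤ x * (x + r ^ 2 + p * (r + 1)) := by positivity
    linarith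
  calc _ ≤ x ^ p * (1 + p / x) * ((x + 1) / (x + 1 - (r + 1))) := by
        gcongr
        exact rpow_add_one_le_rpow_mul hp0 hp1 hx0
    _ = x ^ p * ((1 + p / x) * ((x + 1) / (x + 1 - (r + 1)))) := by ring
    _ ≤ x ^ p * (x / (x - (r + 1)) * (1 + p / x - r / x ^ 2)) := by gcongr
    _ = _ := by ring

theorem duplication_factor_upper_step {p r x : ℝ} (hp0 : 0 ≤ p) (hp1 : p ≤ 1) (hr : 0 ≤ r)
    (hx : 1 < x) :
    x ^ p * ((x - 1) / x) * (1 + p / x - r / x ^ 2) ≤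
      (x + 1) ^ p * ((x + 1 - 1) / (x + 1)) := by
  have hx0 : 0 < x := by linarith
  have h1 : 0 < x - 1 := by linarith
  have hq : 0 ≤ 1 - p := by linarith
  have hr' : 0 ≤ r / x ^ 2 := by positivity
  have h := rpow_mul_add_one_le hp0 hp1 hx0
  have key : (x + (1 - p)) * ((x - 1) * (x + p)) ≤ x ^ 3 := by
    have := mul_nonneg hp0 hq
    nlinarith [mul_nonneg hx0.le (sq_nonneg (p - 1 / 2))]
  calc _ ≤ x ^ p * ((x - 1) / x) * (1 + p / x) := by
        gcongr
        linarith
    _ = x ^ p * (x + 1) * ((x - 1) * (x + p)) / (x ^ 2 * (x + 1)) := by field_simp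
    _ ≤ (x + 1) ^ p * (x + (1 - p)) * ((x - 1) * (x + p)) / (x ^ 2 * (x + 1)) := by gcongr
    _ = (x + 1) ^ p * ((x + (1 - p)) * ((x - 1) * (x + p))) / (x ^ 2 * (x + 1)) := by ring
    _ ≤ (x + 1) ^ p * x ^ 3 / (x ^ 2 * (x + 1)) := by gcongr
    _ = _ := by field_simp; ring

/-- Asymptotics of the homogeneous factor of the duplication-divergence degree recurrence:
for `p ∈ (0,1]` and `r ≥ 0` there are `s₀ ≥ 1` and constants `0 < c₁ ≤ c₂` such that for all
`s₀ ≤ s ≤ t`: `c₁·(t/s)^p ≤ ∏_{k=s}^{t−1}(1 + p/k − r/k²) ≤ c₂·(t/s)^p`. -/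
theorem homogeneous_product_theta_bound
    (p r : ℝ) (hp0 : 0 < p) (hp1 : p ≤ 1) (hr : 0 ≤ r) :
    ∃ (s₀ : ℕ) (c₁ c₂ : ℝ), 1 ≤ s₀ ∧ 0 < c₁ ∧ c₁ ≤ c₂ ∧
      ∀ s t : ℕ, s₀ ≤ s → s ≤ t →
        c₁ * ((t : ℝ) / (s : ℝ)) ^ p
            ≤ ∏ k ∈ Finset.Ico s t, (1 + p / (k : ℝ) - r / (k : ℝ) ^ 2) ∧
        (∏ k ∈ Finset.Ico s t, (1 + p / (k : ℝ) - r / (k : ℝ) ^ 2))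
            ≤ c₂ * ((t : ℝ) / (s : ℝ)) ^ p := by
  obtain ⟨N, hN⟩ := exists_nat_ge (2 * (r + 1))
  have hN2 : (2 : ℝ) ≤ N := by linarith
  refine ⟨N, 1 / 2, 2, ?_, by norm_num, by norm_num, fun s t hs hst => ?_⟩
  · have : (1 : ℝ) ≤ N := by linarith
    exact_mod_cast this
  have hlarge : ∀ k : ℕ, s ≤ k → 2 * (r + 1) ≤ (k : ℝ) := fun k hk =>
    hN.trans (by exact_mod_cast hs.trans hk)
  have hf : ∀ k : ℕ, s ≤ k → 0 ≤ 1 + p / (k : ℝ) - r / (k : ℝ) ^ 2 := by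
    intro k hk
    have hk' := hlarge k hk
    have hk0 : (0 : ℝ) < k := by linarith
    have h1 : r / (k : ℝ) ^ 2 ≤ 1 := by
      rw [div_le_one (by positivity)]
      nlinarith
    have h2 : 0 ≤ p / (k : ℝ) := by positivity
    linarith
  have lower := le_mul_prod_Ico_of_le_mul
    (a := fun k : ℕ => (k : ℝ) ^ p * (k / (k - (r + 1)))) hst hf (by
      intro k hk
      have hk' := hlarge k hk
      push_cast
      exact duplication_factor_lower_step hp0.le hp1 hr (by linarith))
  have upper := mul_prod_Ico_le_of_mul_le
    (a := fun k : ℕ => (k : ℝ) ^ p * ((k - 1) / k)) hst hf (by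
      intro k hk
      have hk' := hlarge k hk
      push_cast
      exact duplication_factor_upper_step hp0.le hp1 hr (by linarith))
  have hP : 0 ≤ ∏ k ∈ Finset.Ico s t, (1 + p / (k : ℝ) - r / (k : ℝ) ^ 2) :=
    Finset.prod_nonneg fun k hk => hf k (Finset.mem_Ico.mp hk).1
  have hs' := hlarge s le_rfl
  have ht' := hlarge t hst
  have hs0 : (0 : ℝ) < s := by linarith
  have ht0 : (0 : ℝ) < t := by linarith
  have hsp : (0 : ℝ) < (s : ℝ) ^ p := by positivity
  have htp : (0 : ℝ) < (t : ℝ) ^ p := by positivity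
  have hLt : 1 ≤ (t : ℝ) / (t - (r + 1)) := by
    rw [le_div_iff₀ (by linarith)]
    linarith
  have hLs : (s : ℝ) / (s - (r + 1)) ≤ 2 := by
    rw [div_le_iff₀ (by linarith)]
    linarith
  have hUt : ((t : ℝ) - 1) / t ≤ 1 := by
    rw [div_le_iff₀ ht0]
    linarith
  have hUs : 1 / 2 ≤ ((s : ℝ) - 1) / s := by
    rw [le_div_iff₀ hs0]
    linarith
  rw [Real.div_rpow ht0.le hs0.le, ← mul_div_assoc, ← mul_div_assoc, div_le_iff₀ hsp,
    le_div_iff₀ hsp]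
  beta_reduce at lower upper
  generalize ∏ k ∈ Finset.Ico s t, (1 + p / (k : ℝ) - r / (k : ℝ) ^ 2) = P at *
  constructor
  · have h1 := le_mul_of_one_le_right htp.le hLt
    have h2 : (s : ℝ) ^ p * (s / (s - (r + 1))) * P ≤ (s : ℝ) ^ p * 2 * P := by gcongr
    linarith
  · have h1 := mul_le_of_le_one_right htp.le hUt
    have h2 : (s : ℝ) ^ p * (1 / 2) * P ≤ (s : ℝ) ^ p * ((s - 1) / s) * P := by gcongr
    linarith
end

section
/- Let p ∈ (0,1] and r ≥ 0 be real numbers. There exist a natural number s₀ ≥ 1 and a real constant C > 0 such that for all natural numbers s, t with s₀ ≤ s ≤ t: Σ_{j=s}^{t−1} (r/j)·∏_{k=j+1}^{t−1} (1 + p/k − r/k²) ≤ C·(t/s)^p. -/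
open Finset

theorem one_add_div_le_rpow (p x : ℝ) (hp : 0 ≤ p) (hx : 1 < x) :
    1 + p / x ≤ (x / (x - 1)) ^ p := by
  have hx0 : 0 < x := by linarith
  have hy : 0 < x / (x - 1) := div_pos hx0 (by linarith)
  have hlog : 1 / x ≤ Real.log (x / (x - 1)) := by
    have h := Real.one_sub_inv_le_log_of_pos hy
    have e : 1 - (x / (x - 1))⁻¹ = 1 / x := by
      rw [inv_div]
      field_simp
      ring
    rwa [e] at h
  rw [Real.rpow_def_of_pos hy]
  calc 1 + p / x = 1 / x * p + 1 := by ring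
    _ ≤ Real.log (x / (x - 1)) * p + 1 := by gcongr
    _ ≤ Real.exp (Real.log (x / (x - 1)) * p) := Real.add_one_le_exp _

theorem one_add_div_sub_div_sq_nonneg (p r x : ℝ) (hp : 0 ≤ p) (hx : 1 ≤ x) (hrx : r ≤ x) :
    0 ≤ 1 + p / x - r / x ^ 2 := by
  have h1 : r / x ^ 2 ≤ 1 := by
    rw [div_le_one (by positivity)]
    nlinarith
  have h2 : 0 ≤ p / x := by positivity
  linarith

theorem sum_mul_prod_Ico_succ (f g : ℕ → ℝ) {s t : ℕ} (hst : s ≤ t) :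
    ∑ j ∈ Finset.Ico s (t + 1), f j * ∏ k ∈ Finset.Ico (j + 1) (t + 1), g k =
      (∑ j ∈ Finset.Ico s t, f j * ∏ k ∈ Finset.Ico (j + 1) t, g k) * g t + f t := by
  rw [Finset.sum_Ico_succ_top hst, Finset.Ico_self, Finset.prod_empty, mul_one, Finset.sum_mul]
  congr 1
  refine Finset.sum_congr rfl fun j hj => ?_
  rw [Finset.prod_Ico_succ_top (Finset.mem_Ico.1 hj).2, mul_assoc]

theorem inhomogeneous_sum_add_le (p r : ℝ) (hp : 0 < p) (hr : 0 ≤ r) {s t : ℕ}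
    (hs : 2 ≤ s) (hrs : r ≤ s) (hst : s ≤ t) :
    (∑ j ∈ Finset.Ico s t,
        (r / (j : ℝ)) * ∏ k ∈ Finset.Ico (j + 1) t, (1 + p / (k : ℝ) - r / (k : ℝ) ^ 2)) + r / p
      ≤ r / p * (((t : ℝ) - 1) / ((s : ℝ) - 1)) ^ p := by
  have hs' : (2 : ℝ) ≤ s := by exact_mod_cast hs
  induction t, hst using Nat.le_induction with
  | base => simp [div_self (show (s : ℝ) - 1 ≠ 0 by linarith)]
  | succ t hst ih =>
    have hst' : (s : ℝ) ≤ t := by exact_mod_cast hst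
    rw [sum_mul_prod_Ico_succ (fun j : ℕ => r / (j : ℝ))
      (fun k : ℕ => 1 + p / (k : ℝ) - r / (k : ℝ) ^ 2) hst]
    have hnonneg : 0 ≤ ∑ j ∈ Finset.Ico s t,
        (r / (j : ℝ)) * ∏ k ∈ Finset.Ico (j + 1) t, (1 + p / (k : ℝ) - r / (k : ℝ) ^ 2) := by
      refine Finset.sum_nonneg fun j hj => mul_nonneg (by positivity)
        (Finset.prod_nonneg fun k hk => ?_)
      have hsk : (s : ℝ) ≤ k := by
        rw [Finset.mem_Ico] at hj hk
        exact_mod_cast (by omega : s ≤ k)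
      exact one_add_div_sub_div_sq_nonneg p r k hp.le (by linarith) (by linarith)
    set S := ∑ j ∈ Finset.Ico s t,
        (r / (j : ℝ)) * ∏ k ∈ Finset.Ico (j + 1) t, (1 + p / (k : ℝ) - r / (k : ℝ) ^ 2)
    have ht : (0 : ℝ) < t := by linarith
    have hbase : 0 ≤ ((t : ℝ) - 1) / ((s : ℝ) - 1) :=
      div_nonneg (by linarith) (by linarith)
    calc S * (1 + p / (t : ℝ) - r / (t : ℝ) ^ 2) + r / (t : ℝ) + r / p
        ≤ S * (1 + p / (t : ℝ)) + r / (t : ℝ) + r / p := by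
          gcongr
          exact sub_le_self _ (by positivity)
      _ = (S + r / p) * (1 + p / (t : ℝ)) := by
          field_simp
          ring
      _ ≤ (r / p * (((t : ℝ) - 1) / ((s : ℝ) - 1)) ^ p) * ((t : ℝ) / ((t : ℝ) - 1)) ^ p := by
          gcongr
          exact one_add_div_le_rpow p t hp.le (by linarith)
      _ = r / p * (((t + 1 : ℕ) : ℝ) - 1) ^ p / ((s : ℝ) - 1) ^ p := by
          rw [mul_assoc, ← Real.mul_rpow hbase (div_nonneg ht.le (by linarith)), mul_div_assoc,
            ← Real.div_rpow (by push_cast; linarith) (by linarith)]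
          congr 2
          have : (t : ℝ) - 1 ≠ 0 := by linarith
          have : (s : ℝ) - 1 ≠ 0 := by linarith
          push_cast
          field_simp
          ring
      _ = r / p * ((((t + 1 : ℕ) : ℝ) - 1) / ((s : ℝ) - 1)) ^ p := by
          rw [mul_div_assoc, ← Real.div_rpow (by push_cast; linarith) (by linarith)]

/-- Bound on the inhomogeneous term of the duplication-divergence degree recurrence:
for `p ∈ (0,1]` and `r ≥ 0` there are `s₀ ≥ 1` and a constant `C > 0` such that for all
`s₀ ≤ s ≤ t`: `Σ_{j=s}^{t−1} (r/j)·∏_{k=j+1}^{t−1}(1 + p/k − r/k²) ≤ C·(t/s)^p`. -/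
theorem inhomogeneous_sum_upper_bound
    (p r : ℝ) (hp0 : 0 < p) (hp1 : p ≤ 1) (hr : 0 ≤ r) :
    ∃ (s₀ : ℕ) (C : ℝ), 1 ≤ s₀ ∧ 0 < C ∧
      ∀ s t : ℕ, s₀ ≤ s → s ≤ t →
        (∑ j ∈ Finset.Ico s t,
            (r / (j : ℝ)) * ∏ k ∈ Finset.Ico (j + 1) t, (1 + p / (k : ℝ) - r / (k : ℝ) ^ 2))
          ≤ C * ((t : ℝ) / (s : ℝ)) ^ p := by
  obtain ⟨n, hn⟩ := exists_nat_ge r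
  refine ⟨max 2 n, r / p * 2 ^ p + 1, by omega, by positivity, fun s t hs hst => ?_⟩
  have hs2 : 2 ≤ s := (le_max_left _ _).trans hs
  have hrs : r ≤ s := hn.trans (by exact_mod_cast (le_max_right _ _).trans hs)
  have hs' : (2 : ℝ) ≤ s := by exact_mod_cast hs2
  have hst' : (s : ℝ) ≤ t := by exact_mod_cast hst
  have hle : ((t : ℝ) - 1) / ((s : ℝ) - 1) ≤ 2 * ((t : ℝ) / s) := by
    rw [← mul_div_assoc, div_le_div_iff₀ (by linarith) (by linarith)]
    nlinarith
  have hpow : (((t : ℝ) - 1) / ((s : ℝ) - 1)) ^ p ≤ 2 ^ p * ((t : ℝ) / s) ^ p := by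
    rw [← Real.mul_rpow (by norm_num) (by positivity)]
    exact Real.rpow_le_rpow (div_nonneg (by linarith) (by linarith)) hle hp0.le
  have hmain := inhomogeneous_sum_add_le p r hp0 hr hs2 hrs hst
  have hrp : 0 ≤ r / p := by positivity
  have hts : 0 ≤ ((t : ℝ) / s) ^ p := by positivity
  linarith [mul_le_mul_of_nonneg_left hpow hrp]
end

section
/- Let p ∈ (1/2, 1] and r ≥ 0 be real numbers and let 0 < d₁ ≤ d₂ be real constants. There exist a natural number s₀ ≥ 1 and real constants 0 < C₁ ≤ C₂ such that: for every natural number s ≥ s₀ and every sequence a : ℕ → ℝ satisfying (i) d₁·s^{2p−1} ≤ a(s) ≤ d₂·s^{2p−1} and (ii) a(k+1) = a(k)·(1 + p/k − r/k²) + r/k for all k ≥ s, one has C₁·(t/s)^p·s^{2p−1} ≤ a(t) ≤ C₂·(t/s)^p·s^{2p−1} for every natural number t ≥ s. -/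
open Finset

/-- The function `x ↦ x ^ p * (1 + 4 * r / x)` is a subsolution of the homogeneous recurrence. -/
theorem rpow_mul_one_add_div_le_step {p r x : ℝ} (hp0 : 0 ≤ p) (hp1 : p ≤ 1) (hr : 0 ≤ r)
    (hx : 1 ≤ x) (hrx : 4 * r ≤ x) :
    (x + 1) ^ p * (1 + 4 * r / (x + 1)) ≤
      x ^ p * (1 + 4 * r / x) * (1 + p / x - r / x ^ 2) := by
  have hx0 : 0 < x := by linarith
  have hpow : (x + 1) ^ p ≤ x ^ p * (1 + p / x) := by
    have hB := rpow_one_add_le_one_add_mul_self (s := 1 / x) (p := p)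
      (by linarith [one_div_pos.mpr hx0]) hp0 hp1
    have hfac : x + 1 = x * (1 + 1 / x) := by field_simp
    rw [hfac, Real.mul_rpow hx0.le (by positivity)]
    refine mul_le_mul_of_nonneg_left (hB.trans_eq ?_) (by positivity)
    ring
  have hrat : (1 + p / x) * (1 + 4 * r / (x + 1)) ≤
      (1 + 4 * r / x) * (1 + p / x - r / x ^ 2) := by
    have hdiff : (1 + 4 * r / x) * (1 + p / x - r / x ^ 2) -
        (1 + p / x) * (1 + 4 * r / (x + 1)) =
        r * (4 * x * (x + p) - (x + 4 * r) * (x + 1)) / (x ^ 3 * (x + 1)) := by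
      field_simp
      ring
    have hnum : 0 ≤ 4 * x * (x + p) - (x + 4 * r) * (x + 1) := by
      nlinarith [mul_nonneg hx0.le hp0, mul_le_mul_of_nonneg_right hrx (by linarith : 0 ≤ x + 1)]
    have : 0 ≤ r * (4 * x * (x + p) - (x + 4 * r) * (x + 1)) / (x ^ 3 * (x + 1)) := by
      positivity
    linarith
  calc (x + 1) ^ p * (1 + 4 * r / (x + 1))
      ≤ x ^ p * (1 + p / x) * (1 + 4 * r / (x + 1)) := by gcongr
    _ = x ^ p * ((1 + p / x) * (1 + 4 * r / (x + 1))) := by ring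
    _ ≤ x ^ p * ((1 + 4 * r / x) * (1 + p / x - r / x ^ 2)) := by gcongr
    _ = _ := by ring

/-- The function `x ↦ x ^ p * (1 - p / x)` is a supersolution of `y (x + 1) = y x * (1 + p / x)`. -/
theorem rpow_mul_one_sub_div_step_le {p x : ℝ} (hp0 : 0 ≤ p) (hp1 : p ≤ 1) (hx : 0 < x) :
    x ^ p * (1 - p / x) * (1 + p / x) ≤ (x + 1) ^ p * (1 - p / (x + 1)) := by
  have hx1 : 0 < x + 1 := by linarith
  have hinv : 1 / (x + 1) ≤ 1 := by
    rw [div_le_one hx1]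
    linarith
  have hB := rpow_one_add_le_one_add_mul_self (s := -(1 / (x + 1))) (p := p)
    (by linarith) hp0 hp1
  have hfac : x = (x + 1) * (1 + -(1 / (x + 1))) := by
    field_simp
    ring
  calc x ^ p * (1 - p / x) * (1 + p / x) = x ^ p * (1 - (p / x) ^ 2) := by ring
    _ ≤ x ^ p * 1 := by
      gcongr
      linarith [sq_nonneg (p / x)]
    _ = (x + 1) ^ p * (1 + -(1 / (x + 1))) ^ p := by
      rw [mul_one, ← Real.mul_rpow hx1.le (by linarith), ← hfac]
    _ ≤ (x + 1) ^ p * (1 - p / (x + 1)) := by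
      refine mul_le_mul_of_nonneg_left (hB.trans_eq ?_) (by positivity)
      ring

/-- Deterministic core of Lemma 2 (expected degree in the duplication-divergence model):
for `p ∈ (1/2, 1]`, `r ≥ 0` and initial-condition constants `0 < d₁ ≤ d₂`, there exist
`s₀ ≥ 1` and constants `0 < C₁ ≤ C₂` such that every sequence `a` with
`d₁·s^{2p−1} ≤ a(s) ≤ d₂·s^{2p−1}` satisfying the recurrence
`a(k+1) = a(k)·(1 + p/k − r/k²) + r/k` for all `k ≥ s` obeys
`C₁·(t/s)^p·s^{2p−1} ≤ a(t) ≤ C₂·(t/s)^p·s^{2p−1}` for all `t ≥ s ≥ s₀`. -/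
theorem duplication_divergence_expected_degree_theta
    (p r : ℝ) (hp0 : 1 / 2 < p) (hp1 : p ≤ 1) (hr : 0 ≤ r)
    (d₁ d₂ : ℝ) (hd0 : 0 < d₁) (hd : d₁ ≤ d₂) :
    ∃ (s₀ : ℕ) (C₁ C₂ : ℝ), 1 ≤ s₀ ∧ 0 < C₁ ∧ C₁ ≤ C₂ ∧
      ∀ s : ℕ, s₀ ≤ s →
        ∀ a : ℕ → ℝ,
          (d₁ * (s : ℝ) ^ (2 * p - 1) ≤ a s ∧ a s ≤ d₂ * (s : ℝ) ^ (2 * p - 1)) →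
          (∀ k : ℕ, s ≤ k →
            a (k + 1) = a k * (1 + p / (k : ℝ) - r / (k : ℝ) ^ 2) + r / (k : ℝ)) →
          ∀ t : ℕ, s ≤ t →
            C₁ * ((t : ℝ) / (s : ℝ)) ^ p * (s : ℝ) ^ (2 * p - 1) ≤ a t ∧
            a t ≤ C₂ * ((t : ℝ) / (s : ℝ)) ^ p * (s : ℝ) ^ (2 * p - 1) := by
  have hp : 0 < p := by linarith
  have hd2 : 0 < d₂ := by linarith
  refine ⟨max 2 ⌈4 * r⌉₊, d₁ / 2, 2 * (d₂ + r / p), le_max_of_le_left one_le_two, by positivity,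
    by linarith [div_nonneg hr hp.le], ?_⟩
  intro s hs a ⟨hlo, hhi⟩ hrec t ht
  have hs2 : (2 : ℝ) ≤ s := by exact_mod_cast (le_max_left _ _).trans hs
  have hrs : 4 * r ≤ s := Nat.ceil_le.mp ((le_max_right _ _).trans hs)
  have hs0 : (0 : ℝ) < s := by linarith
  have hscale : ∀ x : ℝ, 0 ≤ x →
      (x / s) ^ p * (s : ℝ) ^ (2 * p - 1) = (s : ℝ) ^ (p - 1) * x ^ p := by
    intro x hx
    rw [Real.div_rpow hx hs0.le, show 2 * p - 1 = p + (p - 1) by ring, Real.rpow_add hs0]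
    have := Real.rpow_pos_of_pos hs0 p
    field_simp
  have hscale_s : (s : ℝ) ^ (p - 1) * (s : ℝ) ^ p = (s : ℝ) ^ (2 * p - 1) := by
    rw [← Real.rpow_add hs0]
    ring_nf
  set w : ℝ := (s : ℝ) ^ (p - 1)
  have hw : 0 < w := Real.rpow_pos_of_pos hs0 _
  have hone : 1 ≤ (s : ℝ) ^ (2 * p - 1) :=
    Real.one_le_rpow (by linarith) (by linarith)
  have hrp : 0 ≤ r / p := by positivity
  have key : d₁ / 2 * w * ((t : ℝ) ^ p * (1 + 4 * r / t)) ≤ a t ∧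
      a t + r / p ≤ 2 * (d₂ + r / p) * w * ((t : ℝ) ^ p * (1 - p / t)) := by
    induction t, ht using Nat.le_induction with
    | base =>
      have h1 : 4 * r / (s : ℝ) ≤ 1 := (div_le_one hs0).mpr hrs
      have h2 : p / (s : ℝ) ≤ 1 / 2 := by
        rw [div_le_iff₀ hs0]
        linarith
      constructor
      · calc d₁ / 2 * w * ((s : ℝ) ^ p * (1 + 4 * r / s))
            = d₁ / 2 * (w * (s : ℝ) ^ p) * (1 + 4 * r / s) := by ring
          _ ≤ d₁ / 2 * (w * (s : ℝ) ^ p) * 2 := by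
            gcongr
            linarith
          _ = d₁ * (s : ℝ) ^ (2 * p - 1) := by rw [hscale_s]; ring
          _ ≤ a s := hlo
      · calc a s + r / p ≤ d₂ * (s : ℝ) ^ (2 * p - 1) + r / p * (s : ℝ) ^ (2 * p - 1) :=
              add_le_add hhi (le_mul_of_one_le_right hrp hone)
          _ = 2 * (d₂ + r / p) * (w * (s : ℝ) ^ p) * (1 / 2) := by rw [hscale_s]; ring
          _ ≤ 2 * (d₂ + r / p) * (w * (s : ℝ) ^ p) * (1 - p / s) := by
            gcongr
            linarith
          _ = _ := by ring
    | succ k hk ih =>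
      obtain ⟨ihlo, ihhi⟩ := ih
      have hsk : (s : ℝ) ≤ k := by exact_mod_cast hk
      have hk0 : (0 : ℝ) < k := by linarith
      have hak : 0 ≤ a k := le_trans (by positivity) ihlo
      have hmul : 0 ≤ 1 + p / (k : ℝ) - r / (k : ℝ) ^ 2 := by
        have h1 : r / (k : ℝ) ^ 2 ≤ 1 := by
          rw [div_le_one (by positivity)]
          nlinarith
        have h2 : 0 ≤ p / (k : ℝ) := by positivity
        linarith
      rw [hrec k hk]
      push_cast
      constructor
      · calc d₁ / 2 * w * (((k : ℝ) + 1) ^ p * (1 + 4 * r / ((k : ℝ) + 1)))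
            ≤ d₁ / 2 * w * ((k : ℝ) ^ p * (1 + 4 * r / k) * (1 + p / k - r / (k : ℝ) ^ 2)) := by
              exact mul_le_mul_of_nonneg_left (rpow_mul_one_add_div_le_step hp.le hp1 hr
                (by linarith) (by linarith)) (by positivity)
          _ = d₁ / 2 * w * ((k : ℝ) ^ p * (1 + 4 * r / k)) * (1 + p / k - r / (k : ℝ) ^ 2) := by
              ring
          _ ≤ a k * (1 + p / k - r / (k : ℝ) ^ 2) := by gcongr
          _ ≤ _ := le_add_of_nonneg_right (by positivity)
      · calc a k * (1 + p / k - r / (k : ℝ) ^ 2) + r / k + r / p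
            ≤ a k * (1 + p / k) + r / k + r / p := by
              gcongr
              exact sub_le_self _ (by positivity)
          _ = (a k + r / p) * (1 + p / k) := by
              field_simp
              ring
          _ ≤ 2 * (d₂ + r / p) * w * ((k : ℝ) ^ p * (1 - p / k)) * (1 + p / k) := by gcongr
          _ = 2 * (d₂ + r / p) * w * ((k : ℝ) ^ p * (1 - p / k) * (1 + p / k)) := by ring
          _ ≤ _ := by
              exact mul_le_mul_of_nonneg_left (rpow_mul_one_sub_div_step_le hp.le hp1 hk0)
                (by positivity)
  have ht0 : (0 : ℝ) ≤ t := t.cast_nonneg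
  rw [mul_assoc, mul_assoc, hscale t ht0, ← mul_assoc, ← mul_assoc]
  constructor
  · refine le_trans (mul_le_mul_of_nonneg_left ?_ (by positivity)) key.1
    exact le_mul_of_one_le_right (by positivity) (le_add_of_nonneg_right (by positivity))
  · refine (le_add_of_nonneg_right hrp).trans (key.2.trans ?_)
    refine mul_le_mul_of_nonneg_left ?_ (by positivity)
    exact mul_le_of_le_one_right (by positivity) (sub_le_self _ (by positivity))
end
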